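/- Let G be a finite simple graph with mad(G) < 14/5 and ch_3^d(G) > 7 such that every proper subgraph H of G (obtained from G by deleting at least one vertex or at least one edge) satisfies ch_3^d(H) ≤ 7. Then no two vertices of W_1(G) are adjacent. -/

import Mathlib

open SimpleGraph

/-- `φ` is a proper coloring of `G` that is 3-dynamic: every vertex `v` sees at least
`min 3 (deg v)` distinct colors on its neighborhood. -/
def IsDyn3Coloring {V : Type*} (G : SimpleGraph V) (φ : V → ℕ) : Prop :=
  (∀ u v, G.Adj u v → φ u ≠ φ v) ∧
  ∀ v, min 3 (G.neighborSet v).ncard ≤ (φ '' G.neighborSet v).ncard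

/-- `G` is 3-dynamically colorable from the list assignment `L`. -/
def Dyn3ListColorable {V : Type*} (G : SimpleGraph V) (L : V → Finset ℕ) : Prop :=
  ∃ φ : V → ℕ, IsDyn3Coloring G φ ∧ ∀ v, φ v ∈ L v

/-- `ch_3^d(G) ≤ k` : `G` is 3-dynamically `L`-colorable for every list assignment `L`
with `|L v| ≥ k` for all `v`. -/
def Ch3dLE {V : Type*} (G : SimpleGraph V) (k : ℕ) : Prop :=
  ∀ L : V → Finset ℕ, (∀ v, k ≤ (L v).card) → Dyn3ListColorable G L

/-- `mad(G) < c` : every nonempty subgraph has average degree `< c`. -/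
def MadLT {V : Type*} (G : SimpleGraph V) (c : ℚ) : Prop :=
  ∀ H : G.Subgraph, H.verts.Nonempty →
    (2 * H.edgeSet.ncard : ℚ) / (H.verts.ncard : ℚ) < c

/-- `mad(G) ≤ c` : every nonempty subgraph has average degree `≤ c`. -/
def MadLE {V : Type*} (G : SimpleGraph V) (c : ℚ) : Prop :=
  ∀ H : G.Subgraph, H.verts.Nonempty →
    (2 * H.edgeSet.ncard : ℚ) / (H.verts.ncard : ℚ) ≤ c

/-- Every proper subgraph of `G` (deleting at least one vertex or edge) has
`ch_3^d ≤ k`. -/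
def ProperSubgraphsCh3dLE {V : Type*} (G : SimpleGraph V) (k : ℕ) : Prop :=
  ∀ H : G.Subgraph, H ≠ ⊤ → Ch3dLE H.coe k

/-- `x ∈ W_i(G)` : `x` has degree 3 and exactly `i` neighbors of degree 2. -/
def Wmem {V : Type*} (G : SimpleGraph V) (i : ℕ) (x : V) : Prop :=
  (G.neighborSet x).ncard = 3 ∧
    {y | G.Adj x y ∧ (G.neighborSet y).ncard = 2}.ncard = i

/-- `y` is a weak neighbor of `x` : they are distinct and have a common neighbor of
degree 2. -/
def WeakAdj {V : Type*} (G : SimpleGraph V) (x y : V) : Prop :=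
  x ≠ y ∧ ∃ w, G.Adj x w ∧ G.Adj y w ∧ (G.neighborSet w).ncard = 2

lemma pick7 (L B : Finset ℕ) (hL : 7 ≤ L.card) (hB : B.card ≤ 6) : ∃ c ∈ L, c ∉ B := by
  by_contra! h
  have := Finset.card_le_card (show L ⊆ B from h)
  omega

lemma W1_struct {V : Type*} [Fintype V] (G : SimpleGraph V) (x y : V) (hx : Wmem G 1 x)
    (hy : (G.neighborSet y).ncard = 3) (h : G.Adj x y) :
    ∃ a p a', G.neighborSet x = {y, a, p} ∧ y ≠ a ∧ y ≠ p ∧ a ≠ p ∧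
      G.neighborSet a = {x, a'} ∧ x ≠ a' ∧ (G.neighborSet a).ncard = 2 ∧
      (G.neighborSet p).ncard ≠ 2 := by
  obtain ⟨h3, h1⟩ := hx
  obtain ⟨a, ha⟩ := Set.ncard_eq_one.1 h1
  have haa : G.Adj x a ∧ (G.neighborSet a).ncard = 2 := by
    have : a ∈ ({a} : Set V) := rfl
    rw [← ha] at this; exact this
  have hya : y ≠ a := by rintro rfl; omega
  have hsub : ({y, a} : Set V) ⊆ G.neighborSet x := by
    rintro z (rfl | rfl)
    · exact h
    · exact haa.1
  have hd := Set.ncard_diff hsub (Set.toFinite _)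
  rw [h3, Set.ncard_pair hya] at hd
  obtain ⟨p, hp⟩ := Set.ncard_eq_one.1 hd
  have hpm : p ∈ G.neighborSet x \ {y, a} := by rw [hp]; rfl
  have hpy : y ≠ p := by rintro rfl; exact hpm.2 (by simp)
  have hpa : a ≠ p := by rintro rfl; exact hpm.2 (by simp)
  have hxa : ({x} : Set V) ⊆ G.neighborSet a := by
    rintro z rfl; exact haa.1.symm
  have hd2 := Set.ncard_diff hxa (Set.toFinite _)
  rw [haa.2, Set.ncard_singleton] at hd2
  obtain ⟨a', ha'⟩ := Set.ncard_eq_one.1 hd2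
  have ham : a' ∈ G.neighborSet a \ {x} := by rw [ha']; rfl
  refine ⟨a, p, a', ?_, hya, hpy, hpa, ?_, ?_, haa.2, ?_⟩
  · rw [← Set.diff_union_of_subset hsub, hp]; ext z; simp <;> tauto
  · rw [← Set.diff_union_of_subset hxa, ha']; ext z; simp <;> tauto
  · rintro rfl; exact ham.2 rfl
  · intro hp2
    have : p ∈ {y | G.Adj x y ∧ (G.neighborSet y).ncard = 2} := ⟨hpm.1, hp2⟩
    rw [ha] at this
    exact hpa this.symm

/-- coloring of the graph with all edges meeting `S` removed -/
lemma reduce_col {V : Type*} (G : SimpleGraph V) (hmin : ProperSubgraphsCh3dLE G 7)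
    (S : Set V) (x y : V) (hx : x ∈ S) (h : G.Adj x y) (L : V → Finset ℕ)
    (hL : ∀ v, 7 ≤ (L v).card) :
    ∃ φ : V → ℕ, (∀ v, φ v ∈ L v) ∧ (∀ u v, u ∉ S → v ∉ S → G.Adj u v → φ u ≠ φ v) ∧
      ∀ v, v ∉ S → min 3 (G.neighborSet v \ S).ncard ≤ (φ '' (G.neighborSet v \ S)).ncard := by
  let H : G.Subgraph :=
    { verts := Set.univ
      Adj := fun u v => G.Adj u v ∧ u ∉ S ∧ v ∉ S
      adj_sub := fun h => h.1
      edge_vert := fun _ => trivial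
      symm := ⟨fun u v h => ⟨h.1.symm, h.2.2, h.2.1⟩⟩ }
  have hH : H ≠ ⊤ := by
    intro e
    have : H.Adj x y := by rw [e]; exact h
    exact this.2.1 hx
  obtain ⟨ψ, ⟨h1, h2⟩, h3⟩ := hmin H hH (fun v => L v) (fun v => hL v)
  refine ⟨fun v => ψ ⟨v, trivial⟩, fun v => h3 _, fun u v hu hv huv => h1 _ _ ⟨huv, hu, hv⟩, ?_⟩
  intro v hv
  have h4 := h2 ⟨v, trivial⟩
  have e1 : G.neighborSet v \ S = Subtype.val '' (H.coe.neighborSet ⟨v, trivial⟩) := by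
    ext z
    constructor
    · rintro ⟨hz, hz'⟩
      exact ⟨⟨z, trivial⟩, ⟨hz, hv, hz'⟩, rfl⟩
    · rintro ⟨⟨z, _⟩, ⟨hz, _, hz'⟩, rfl⟩
      exact ⟨hz, hz'⟩
  rw [e1, Set.ncard_image_of_injective _ Subtype.val_injective, Set.image_image]
  exact h4

lemma exists_forb {V : Type*} [Fintype V] (G : SimpleGraph V) (S : Set V) (φ : V → ℕ) (v : V) :
    ∃ F : Finset ℕ, F.card ≤ 3 ∧ φ v ∈ F ∧
      (v ∉ S → (G.neighborSet v \ S).ncard ≤ 2 → ∀ u ∈ G.neighborSet v \ S, φ u ∈ F) ∧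
      (v ∈ S ∨ (G.neighborSet v \ S).ncard ≤ 1 → F.card ≤ 2) := by
  classical
  by_cases h : v ∉ S ∧ (G.neighborSet v \ S).ncard ≤ 2
  · have hc : (insert (φ v) ((Set.toFinite (G.neighborSet v \ S)).toFinset.image φ)).card ≤
        (G.neighborSet v \ S).ncard + 1 := by
      refine (Finset.card_insert_le _ _).trans ?_
      rw [Set.ncard_eq_toFinset_card _ (Set.toFinite _)]
      exact Nat.add_le_add_right Finset.card_image_le 1
    refine ⟨insert (φ v) ((Set.toFinite (G.neighborSet v \ S)).toFinset.image φ), ?_, by simp, ?_, ?_⟩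
    · omega
    · intro _ _ u hu
      refine Finset.mem_insert_of_mem (Finset.mem_image_of_mem _ ?_)
      simpa using hu
    · rintro (h' | h')
      · exact absurd h' h.1
      · omega
  · refine ⟨{φ v}, by simp, by simp, fun h1 h2 => absurd ⟨h1, h2⟩ h, by simp⟩

lemma dyn_off {V : Type*} [Fintype V] (G : SimpleGraph V) (S : Set V) (φ0 φ : V → ℕ) (v : V)
    (hag : ∀ u, u ∉ S → φ u = φ0 u)
    (h0 : min 3 (G.neighborSet v \ S).ncard ≤ (φ0 '' (G.neighborSet v \ S)).ncard)
    (hav : (G.neighborSet v \ S).ncard ≤ 2 → ∀ z ∈ G.neighborSet v ∩ S,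
      ∀ u ∈ G.neighborSet v \ S, φ z ≠ φ0 u)
    (hinj : 2 ≤ (G.neighborSet v \ S).ncard ∨ Set.InjOn φ (G.neighborSet v ∩ S)) :
    min 3 (G.neighborSet v).ncard ≤ (φ '' G.neighborSet v).ncard := by
  have him : φ '' (G.neighborSet v \ S) = φ0 '' (G.neighborSet v \ S) :=
    Set.image_congr fun u hu => hag u hu.2
  have hmono : (φ '' (G.neighborSet v \ S)).ncard ≤ (φ '' G.neighborSet v).ncard :=
    Set.ncard_le_ncard (Set.image_mono Set.sdiff_subset) (Set.toFinite _)
  rw [← him] at h0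
  by_cases h3 : 3 ≤ (G.neighborSet v \ S).ncard
  · omega
  have h2 : (G.neighborSet v \ S).ncard ≤ 2 := by omega
  have hav := hav h2
  have hle := Set.ncard_image_le (f := φ) (Set.toFinite (G.neighborSet v \ S))
  have heq : (φ '' (G.neighborSet v \ S)).ncard = (G.neighborSet v \ S).ncard := by omega
  have hio := (Set.ncard_image_iff (Set.toFinite _)).1 heq
  have hinj' : 2 ≤ (G.neighborSet v \ S).ncard ∨ (¬ 2 ≤ (G.neighborSet v \ S).ncard ∧
      Set.InjOn φ (G.neighborSet v ∩ S)) := by tauto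
  rcases hinj' with h | ⟨_, h⟩
  · rcases (G.neighborSet v ∩ S).eq_empty_or_nonempty with he | ⟨z, hz⟩
    · have : G.neighborSet v \ S = G.neighborSet v := by
        ext w
        constructor
        · exact fun h => h.1
        · intro h
          refine ⟨h, fun hw => ?_⟩
          have : w ∈ G.neighborSet v ∩ S := ⟨h, hw⟩
          rw [he] at this
          exact this
      rw [this] at h0; exact h0
    · have hn : φ z ∉ φ '' (G.neighborSet v \ S) := by
        rintro ⟨u, hu, e⟩
        exact hav z hz u hu (by rw [← e, hag u hu.2])
      have := Set.ncard_insert_of_notMem hn (Set.toFinite _)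
      have h5 : (insert (φ z) (φ '' (G.neighborSet v \ S))).ncard ≤ (φ '' G.neighborSet v).ncard := by
        refine Set.ncard_le_ncard ?_ (Set.toFinite _)
        refine Set.insert_subset ⟨z, hz.1, rfl⟩ (Set.image_mono Set.sdiff_subset)
      omega
  · have : Set.InjOn φ (G.neighborSet v) := by
      intro s hs t ht e
      by_cases hsS : s ∈ S <;> by_cases htS : t ∈ S
      · exact h ⟨hs, hsS⟩ ⟨ht, htS⟩ e
      · exact absurd (e.trans (hag t htS)) (hav s ⟨hs, hsS⟩ t ⟨ht, htS⟩)
      · exact absurd (e.symm.trans (hag s hsS)) (hav t ⟨ht, htS⟩ s ⟨hs, hsS⟩)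
      · exact hio ⟨hs, hsS⟩ ⟨ht, htS⟩ e
    rw [Set.ncard_image_of_injOn this]
    exact min_le_right _ _

lemma dyn_of_inj {V : Type*} [Fintype V] (G : SimpleGraph V) (φ : V → ℕ) (v : V)
    (h : Set.InjOn φ (G.neighborSet v)) :
    min 3 (G.neighborSet v).ncard ≤ (φ '' G.neighborSet v).ncard := by
  rw [Set.ncard_image_of_injOn h]
  exact min_le_right _ _

lemma verify {V : Type*} [Fintype V] (G : SimpleGraph V) (x y a b p q a' b' : V)
    (φ0 φ : V → ℕ) (F : V → Finset ℕ) (S : Set V) (hS : S = {x, y, a, b})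
    (Nx : G.neighborSet x = {y, a, p}) (Ny : G.neighborSet y = {x, b, q})
    (Na : G.neighborSet a = {x, a'}) (Nb : G.neighborSet b = {y, b'})
    (hF : ∀ v, v ∉ S → (G.neighborSet v \ S).ncard ≤ 2 → ∀ u ∈ G.neighborSet v \ S, φ0 u ∈ F v)
    (h1 : ∀ u v, u ∉ S → v ∉ S → G.Adj u v → φ0 u ≠ φ0 v)
    (h2 : ∀ v, v ∉ S → min 3 (G.neighborSet v \ S).ncard ≤ (φ0 '' (G.neighborSet v \ S)).ncard)
    (hag : ∀ u, u ∉ S → φ u = φ0 u)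
    (xy : φ x ≠ φ y) (xa : φ x ≠ φ a) (xp : φ x ≠ φ p) (ya : φ y ≠ φ a) (ap : φ a ≠ φ p)
    (yp : φ y ≠ φ p) (xb : φ x ≠ φ b) (yb : φ y ≠ φ b) (xq : φ x ≠ φ q) (yq : φ y ≠ φ q)
    (bq : φ b ≠ φ q) (xa' : φ x ≠ φ a') (aa' : φ a ≠ φ a') (yb' : φ y ≠ φ b')
    (bb' : φ b ≠ φ b')
    (fx : φ x ∉ F p) (fy : φ y ∉ F q) (fa : a' ∉ S → φ a ∉ F a') (fb : b' ∉ S → φ b ∉ F b')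
    (hab : a ≠ b → φ a = φ b → a' = b' → a' ∉ S → 2 ≤ (G.neighborSet a' \ S).ncard) :
    IsDyn3Coloring G φ := by
  have Ax : ∀ z, G.Adj x z → z = y ∨ z = a ∨ z = p := fun z hz => by
    have : z ∈ G.neighborSet x := hz
    rw [Nx] at this; exact this
  have Ay : ∀ z, G.Adj y z → z = x ∨ z = b ∨ z = q := fun z hz => by
    have : z ∈ G.neighborSet y := hz
    rw [Ny] at this; exact this
  have Aa : ∀ z, G.Adj a z → z = x ∨ z = a' := fun z hz => by
    have : z ∈ G.neighborSet a := hz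
    rw [Na] at this; exact this
  have Ab : ∀ z, G.Adj b z → z = y ∨ z = b' := fun z hz => by
    have : z ∈ G.neighborSet b := hz
    rw [Nb] at this; exact this
  have hSP : ∀ u ∈ S, ∀ v, G.Adj u v → φ u ≠ φ v := by
    intro u hu v huv
    rw [hS] at hu
    rcases hu with rfl | rfl | rfl | rfl
    · rcases Ax v huv with rfl | rfl | rfl <;> assumption
    · rcases Ay v huv with rfl | rfl | rfl <;> first | assumption | exact xy.symm
    · rcases Aa v huv with rfl | rfl <;> first | assumption | exact xa.symm
    · rcases Ab v huv with rfl | rfl <;> first | assumption | exact yb.symm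
  constructor
  · intro u v huv
    by_cases hu : u ∈ S
    · exact hSP u hu v huv
    by_cases hv : v ∈ S
    · exact (hSP v hv u huv.symm).symm
    rw [hag u hu, hag v hv]
    exact h1 u v hu hv huv
  intro v
  by_cases hv : v ∈ S
  · apply dyn_of_inj
    rw [hS] at hv
    rcases hv with rfl | rfl | rfl | rfl
    · rw [Nx]
      rintro s (rfl | rfl | rfl) t (rfl | rfl | rfl) e <;> first | rfl | (exfalso; grind)
    · rw [Ny]
      rintro s (rfl | rfl | rfl) t (rfl | rfl | rfl) e <;> first | rfl | (exfalso; grind)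
    · rw [Na]
      rintro s (rfl | rfl) t (rfl | rfl) e <;> first | rfl | (exfalso; grind)
    · rw [Nb]
      rintro s (rfl | rfl) t (rfl | rfl) e <;> first | rfl | (exfalso; grind)
  · have hv' := hv
    rw [hS] at hv'
    simp only [Set.mem_insert_iff, Set.mem_singleton_iff, not_or] at hv'
    obtain ⟨vx, vy, va, vb⟩ := hv'
    apply dyn_off G S φ0 φ v hag (h2 v hv)
    · rintro hle z ⟨hz, hzS⟩ u hu e
      have hm := hF v hv hle u hu
      rw [← e] at hm
      have hz' : G.Adj z v := SimpleGraph.Adj.symm hz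
      rw [hS] at hzS
      rcases hzS with rfl | rfl | rfl | rfl
      · rcases Ax v hz' with h | h | h
        · exact vy h
        · exact va h
        · subst h; exact fx hm
      · rcases Ay v hz' with h | h | h
        · exact vx h
        · exact vb h
        · subst h; exact fy hm
      · rcases Aa v hz' with h | h
        · exact vx h
        · subst h; exact fa hv hm
      · rcases Ab v hz' with h | h
        · exact vy h
        · subst h; exact fb hv hm
    · by_cases hle : 2 ≤ (G.neighborSet v \ S).ncard
      · exact Or.inl hle
      right
      have key : G.Adj a v → G.Adj b v → φ a = φ b → a = b := by
        intro h1 h2 e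
        by_contra hne
        rcases Aa v h1 with h | h
        · exact vx h
        rcases Ab v h2 with h' | h'
        · exact vy h'
        subst h
        exact hle (hab hne e h' hv)
      rintro s ⟨hs, hsS⟩ t ⟨ht, htS⟩ e
      have hs' : G.Adj s v := SimpleGraph.Adj.symm hs
      have ht' : G.Adj t v := SimpleGraph.Adj.symm ht
      rw [hS] at hsS htS
      clear hs ht hF h1 h2 hag fx fy fa fb hab hSP Ax Ay Aa Ab Nx Ny Na Nb hS
      rcases hsS with rfl | rfl | rfl | rfl <;> rcases htS with rfl | rfl | rfl | rfl <;>
        first | rfl | (exact absurd e (by assumption)) | (exact absurd e.symm (by assumption)) | (exact key hs' ht' e) | (exact (key ht' hs' e.symm).symm)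

theorem min_counterexample7_no_adjacent_W1 {V : Type*} [Fintype V]
    (G : SimpleGraph V) (hmad : MadLT G (14 / 5)) (hG : ¬ Ch3dLE G 7)
    (hmin : ProperSubgraphsCh3dLE G 7) :
    ∀ x y : V, Wmem G 1 x → Wmem G 1 y → ¬ G.Adj x y := by
  classical
  intro x y hx hy hxy
  apply hG
  intro L hL
  obtain ⟨a, p, a', Nx, ya, yp, ap, Na, xa', da, dp⟩ := W1_struct G x y hx hy.1 hxy
  obtain ⟨b, q, b', Ny, xb, xq, bq, Nb, yb', db, dq⟩ := W1_struct G y x hy hx.1 hxy.symm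
  have ax : G.Adj x a := by
    have : a ∈ G.neighborSet x := by rw [Nx]; simp
    exact this
  have px : G.Adj x p := by
    have : p ∈ G.neighborSet x := by rw [Nx]; simp
    exact this
  have bY : G.Adj y b := by
    have : b ∈ G.neighborSet y := by rw [Ny]; simp
    exact this
  have qy : G.Adj y q := by
    have : q ∈ G.neighborSet y := by rw [Ny]; simp
    exact this
  have aa' : G.Adj a a' := by
    have : a' ∈ G.neighborSet a := by rw [Na]; simp
    exact this
  have bb' : G.Adj b b' := by
    have : b' ∈ G.neighborSet b := by rw [Nb]; simp
    exact this
  have hpb : p ≠ b := by rintro rfl; exact dp db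
  have hqa : q ≠ a := by rintro rfl; exact dq da
  have nxy := hxy.ne
  have nax := ax.ne
  have npx := px.ne
  have nby := bY.ne
  have nqy := qy.ne
  have naa := aa'.ne
  have nbb := bb'.ne
  obtain ⟨S, hS⟩ : ∃ S : Set V, S = {x, y, a, b} := ⟨_, rfl⟩
  have memS : ∀ v, v ∈ S ↔ v = x ∨ v = y ∨ v = a ∨ v = b := by
    intro v; rw [hS]; simp
  obtain ⟨φ0, hφL, h1, h2⟩ := reduce_col G hmin S x y ((memS x).2 (Or.inl rfl)) hxy L hL
  choose F F3 Fv FN F2 using exists_forb G S φ0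
  obtain ⟨cx, cxL, hcx⟩ := pick7 (L x) (insert (φ0 a') (insert (φ0 q) (F p))) (hL x) (by
    have := F3 p
    have := Finset.card_insert_le (φ0 q) (F p)
    have := Finset.card_insert_le (φ0 a') (insert (φ0 q) (F p))
    omega)
  obtain ⟨cy, cyL, hcy⟩ := pick7 (L y) (insert cx (insert (φ0 b') (insert (φ0 p) (F q)))) (hL y) (by
    have := F3 q
    have := Finset.card_insert_le (φ0 p) (F q)
    have := Finset.card_insert_le (φ0 b') (insert (φ0 p) (F q))
    have := Finset.card_insert_le cx (insert (φ0 b') (insert (φ0 p) (F q)))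
    omega)
  have hpS : p ∉ S := by rw [memS]; grind
  have hqS : q ∉ S := by rw [memS]; grind
  have fp := Fv p
  have fq := Fv q
  simp only [Finset.mem_insert, not_or] at hcx hcy
  by_cases hab : a = b
  · subst hab
    obtain ⟨ca, caL, hca⟩ := pick7 (L a) {φ0 p, φ0 q, cx, cy} (hL a)
      (Finset.card_le_four.trans (by omega))
    simp only [Finset.mem_insert, Finset.mem_singleton, not_or] at hca
    have ea' : a' = y := by
      have : y ∈ G.neighborSet a := bY.symm
      rw [Na] at this; rcases this with h | h
      · exact absurd h.symm nxy
      · exact h.symm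
    have eb' : b' = x := by
      have : x ∈ G.neighborSet a := ax.symm
      rw [Nb] at this; rcases this with h | h
      · exact absurd h nxy
      · exact h.symm
    subst ea' eb'
    obtain ⟨φ, hφ⟩ : ∃ φ : V → ℕ, φ = fun v => if v = b' then cx else if v = a' then cy else
      if v = a then ca else φ0 v := ⟨_, rfl⟩
    have hag : ∀ u, u ∉ S → φ u = φ0 u := by
      intro u hu; rw [memS] at hu; simp only [not_or] at hu
      simp [hφ, hu]
    have ex : φ b' = cx := by simp [hφ]
    have ey : φ a' = cy := by simp [hφ, nxy.symm]
    have ea : φ a = ca := by simp [hφ, nax.symm, naa]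
    have ep := hag p hpS
    have eq := hag q hqS
    refine ⟨φ, verify G b' a' a a p q a' b' φ0 φ F S hS Nx Ny Na Nb FN h1 h2 hag ?_ ?_ ?_ ?_ ?_ ?_
      ?_ ?_ ?_ ?_ ?_ ?_ ?_ ?_ ?_ ?_ ?_ ?_ ?_ ?_, ?_⟩
    all_goals clear FN h1 h2 F2 F3 
    all_goals try rw [ex]
    all_goals try rw [ey]
    all_goals try rw [ea]
    all_goals try rw [ep]
    all_goals try rw [eq]
    all_goals try grind
  · have ha'y : a' ≠ y := by
      rintro rfl
      have : a ∈ G.neighborSet a' := aa'.symm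
      rw [Ny] at this
      rcases this with h | h | h
      · exact nax h.symm
      · exact hab h
      · exact hqa h.symm
    have hb'x : b' ≠ x := by
      rintro rfl
      have : b ∈ G.neighborSet b' := bb'.symm
      rw [Nx] at this
      rcases this with h | h | h
      · exact nby h.symm
      · exact hab h.symm
      · exact hpb h.symm
    obtain ⟨ca, caL, hca⟩ := pick7 (L a) (insert cx (insert cy (insert (φ0 p) (F a')))) (hL a) (by
      have := F3 a'
      have := Finset.card_insert_le (φ0 p) (F a')
      have := Finset.card_insert_le cy (insert (φ0 p) (F a'))
      have := Finset.card_insert_le cx (insert cy (insert (φ0 p) (F a')))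
      omega)
    obtain ⟨cb, cbL, hcb, hneed⟩ : ∃ cb ∈ L b, cb ∉ insert cx (insert cy (insert (φ0 q) (F b'))) ∧
        ((b' ∈ S ∨ (G.neighborSet b' \ S).ncard ≤ 1) → cb ≠ ca) := by
      have t1 := F3 b'
      have t2 := Finset.card_insert_le (φ0 q) (F b')
      have t3 := Finset.card_insert_le cy (insert (φ0 q) (F b'))
      have t4 := Finset.card_insert_le cx (insert cy (insert (φ0 q) (F b')))
      have t5 := Finset.card_insert_le ca (insert cx (insert cy (insert (φ0 q) (F b'))))
      by_cases hn : b' ∈ S ∨ (G.neighborSet b' \ S).ncard ≤ 1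
      · have t6 := F2 b' hn
        obtain ⟨cb, h, h'⟩ := pick7 (L b) _ (hL b) (t5.trans (by omega))
        rw [Finset.mem_insert, not_or] at h'
        exact ⟨cb, h, h'.2, fun _ => h'.1⟩
      · obtain ⟨cb, h, h'⟩ := pick7 (L b) _ (hL b) (t4.trans (by omega))
        exact ⟨cb, h, h', fun h => absurd h hn⟩
    simp only [Finset.mem_insert, not_or] at hca hcb
    have hA : a' ∉ S ∨ (a' = b ∧ b' = a) := by
      by_cases h : a' ∈ S
      · right
        rw [memS] at h
        have e : a' = b := by grind
        refine ⟨e, ?_⟩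
        subst e
        have : a ∈ G.neighborSet a' := aa'.symm
        rw [Nb] at this
        rcases this with h | h
        · exact absurd h.symm ya
        · exact h.symm
      · exact Or.inl h
    have hB : b' ∉ S ∨ (a' = b ∧ b' = a) := by
      by_cases h : b' ∈ S
      · right
        rw [memS] at h
        have e : b' = a := by grind
        refine ⟨?_, e⟩
        subst e
        have : b ∈ G.neighborSet b' := bb'.symm
        rw [Na] at this
        rcases this with h | h
        · exact absurd h.symm xb
        · exact h.symm
      · exact Or.inl h
    obtain ⟨φ, hφ⟩ : ∃ φ : V → ℕ, φ = fun v => if v = x then cx else if v = y then cy else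
      if v = a then ca else if v = b then cb else φ0 v := ⟨_, rfl⟩
    have hag : ∀ u, u ∉ S → φ u = φ0 u := by
      intro u hu; rw [memS] at hu; simp only [not_or] at hu
      simp [hφ, hu]
    have ex : φ x = cx := by simp [hφ]
    have ey : φ y = cy := by simp [hφ, nxy.symm]
    have ea : φ a = ca := by simp [hφ, nax.symm, ya.symm]
    have eb : φ b = cb := by simp [hφ, nby.symm, xb.symm, Ne.symm hab]
    have ep := hag p hpS
    have eq := hag q hqS
    have haS : a ∈ S := by rw [memS]; simp
    have ga := Fv a'
    have gb := Fv b'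
    have hA' := hag a'
    have hB' := hag b'
    have hLL : ∀ v, φ v ∈ L v := by
      intro v
      by_cases hv : v ∈ S
      · rw [memS] at hv
        rcases hv with rfl | rfl | rfl | rfl
        · rwa [ex]
        · rwa [ey]
        · rwa [ea]
        · rwa [eb]
      · rw [hag v hv]; exact hφL v
    refine ⟨φ, verify G x y a b p q a' b' φ0 φ F S hS Nx Ny Na Nb FN h1 h2 hag ?_ ?_ ?_ ?_ ?_ ?_
      ?_ ?_ ?_ ?_ ?_ ?_ ?_ ?_ ?_ ?_ ?_ ?_ ?_ ?_, hLL⟩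
    all_goals clear FN h1 h2 F2 F3 hag hLL hφ hmin hmad hG Nx Ny Na Nb hx hy hS memS
    all_goals grind
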